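/- arXiv:1708.00615 — 3 statements merged into one kernel-verified Lean document; each statement's English description precedes it below -/
import Mathlib

section
/- If p is an odd prime and G is a Miller p-group, then the subgroup Z(G) ∩ Φ(G) is not cyclic. -/
/-- A Miller group: a finite non-abelian group whose full automorphism group is abelian. -/
def IsMiller (G : Type*) [Group G] : Prop :=
  Finite G ∧ (∃ a b : G, a * b ≠ b * a) ∧ ∀ φ ψ : MulAut G, φ * ψ = ψ * φ

open scoped commutatorElement

section CyclicGroups

theorem IsCyclic.mem_zpowers_of_orderOf_dvd {C : Type*} [Group C] [Finite C] [IsCyclic C]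
    {x y : C} (h : orderOf y ∣ orderOf x) : y ∈ Subgroup.zpowers x := by
  classical
  have := Fintype.ofFinite C
  have hsub : (Subgroup.zpowers x : Set C).toFinset ⊆
      Finset.univ.filter fun b : C => b ^ orderOf x = 1 := by
    intro b hb
    simp only [Set.mem_toFinset, SetLike.mem_coe] at hb
    obtain ⟨k, rfl⟩ := hb
    simp only [Finset.mem_filter, Finset.mem_univ, true_and]
    rw [← zpow_natCast, ← zpow_mul, mul_comm, zpow_mul, zpow_natCast, pow_orderOf_eq_one, one_zpow]
  have hcard : (Finset.univ.filter fun b : C => b ^ orderOf x = 1).card ≤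
      ((Subgroup.zpowers x : Set C).toFinset).card := by
    refine (IsCyclic.card_pow_eq_one_le (orderOf_pos x)).trans ?_
    rw [Set.toFinset_card, ← Nat.card_eq_fintype_card]
    exact (Nat.card_zpowers x).ge
  have hy : y ∈ (Subgroup.zpowers x : Set C).toFinset := by
    rw [Finset.eq_of_subset_of_card_le hsub hcard]
    simpa using orderOf_dvd_iff_pow_eq_one.mp h
  simpa using hy

theorem Subgroup.mem_zpowers_of_isCyclic_of_orderOf_dvd {G : Type*} [Group G] [Finite G]
    {C : Subgroup G} [IsCyclic C] {x y : G} (hx : x ∈ C) (hy : y ∈ C)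
    (h : orderOf y ∣ orderOf x) : y ∈ Subgroup.zpowers x := by
  have h' : orderOf (⟨y, hy⟩ : C) ∣ orderOf (⟨x, hx⟩ : C) := by
    rwa [Subgroup.orderOf_mk, Subgroup.orderOf_mk]
  obtain ⟨k, hk⟩ := IsCyclic.mem_zpowers_of_orderOf_dvd h'
  exact ⟨k, by simpa using congrArg Subtype.val hk⟩

end CyclicGroups

section FrattiniPGroup

variable {G : Type*} [Group G]

theorem IsPGroup.normal_of_isCoatom [Finite G] {p : ℕ} (hp : p.Prime) (hG : IsPGroup p G)
    {M : Subgroup G} (hM : IsCoatom M) : M.Normal := by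
  have := Fact.mk hp
  have := hG.isNilpotent
  exact Subgroup.NormalizerCondition.normal_of_coatom M Group.normalizerCondition_of_isNilpotent hM

theorem IsCoatom.exists_mul_zpow_eq {M : Subgroup G} [M.Normal] (hM : IsCoatom M) {g : G}
    (hg : g ∉ M) (x : G) : ∃ m ∈ M, ∃ k : ℤ, m * g ^ k = x := by
  have htop : M ⊔ Subgroup.zpowers g = ⊤ :=
    hM.2 _ (left_lt_sup.mpr fun h => hg (h (Subgroup.mem_zpowers g)))
  have hx : x ∈ M ⊔ Subgroup.zpowers g := htop ▸ Subgroup.mem_top x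
  obtain ⟨m, hm, _, ⟨k, rfl⟩, h⟩ := Subgroup.mem_sup_of_normal_left.mp hx
  exact ⟨m, hm, k, h⟩

theorem IsPGroup.commutatorElement_mem_frattini [Finite G] {p : ℕ} (hp : p.Prime)
    (hG : IsPGroup p G) (g h : G) :
    ⁅g, h⁆ ∈ frattini G := by
  simp only [frattini, Order.radical, Subgroup.mem_iInf]
  intro M hM
  have := hG.normal_of_isCoatom hp hM
  by_cases hg : g ∈ M
  · rw [commutatorElement_def, mul_assoc, mul_assoc]
    exact M.mul_mem hg (by simpa [mul_assoc] using this.conj_mem _ (M.inv_mem hg) h)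
  · obtain ⟨m, hm, k, rfl⟩ := hM.exists_mul_zpow_eq hg h
    have : ⁅g, m * g ^ k⁆ = g * m * g⁻¹ * m⁻¹ := by
      rw [commutatorElement_def]; group
    rw [this]
    exact M.mul_mem (Subgroup.Normal.conj_mem ‹_› m hm g) (M.inv_mem hm)

theorem IsPGroup.pow_mem_frattini [Finite G] {p : ℕ} (hp : p.Prime) (hG : IsPGroup p G) (g : G) :
    g ^ p ∈ frattini G := by
  simp only [frattini, Order.radical, Subgroup.mem_iInf]
  intro M hM
  have := hG.normal_of_isCoatom hp hM
  by_contra hg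
  obtain ⟨m, hm, k, hk⟩ := hM.exists_mul_zpow_eq hg g
  have hmem : g ^ (1 - p * k : ℤ) ∈ M := by
    have : g ^ (1 - p * k : ℤ) = m := by
      rw [zpow_sub, zpow_one, zpow_mul, zpow_natCast]
      exact mul_inv_eq_of_eq_mul hk.symm
    rwa [this]
  obtain ⟨n, hn⟩ := hG g
  have hcop : IsCoprime (1 - p * k : ℤ) ((p : ℤ) ^ n) :=
    IsCoprime.pow_right ⟨1, k, by ring⟩
  obtain ⟨u, v, huv⟩ := hcop
  have hgM : g ∈ M := by
    have : g = (g ^ (1 - p * k : ℤ)) ^ u := by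
      rw [← zpow_mul, mul_comm, eq_sub_of_add_eq huv, zpow_sub, zpow_one, mul_comm v, zpow_mul]
      have hg1 : g ^ ((p : ℤ) ^ n) = 1 := by exact_mod_cast hn
      simp [hg1]
    rw [this]
    exact M.zpow_mem hmem u
  exact hg (M.pow_mem hgM p)

end FrattiniPGroup

section ClassTwo

variable {G : Type*} [Group G]

theorem commutatorElement_mul_left_of_mem_center
    (hc : ∀ g h : G, ⁅g, h⁆ ∈ Subgroup.center G) (g h x : G) : ⁅g * h, x⁆ = ⁅g, x⁆ * ⁅h, x⁆ := by
  rw [commutatorElement_mul_left_eq_conj_mul, (Subgroup.mem_center_iff.mp (hc h x) g),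
    mul_inv_cancel_right, Subgroup.mem_center_iff.mp (hc g x)]

theorem commutatorElement_zpow_left_of_mem_center
    (hc : ∀ g h : G, ⁅g, h⁆ ∈ Subgroup.center G) (g x : G) (n : ℤ) : ⁅g ^ n, x⁆ = ⁅g, x⁆ ^ n :=
  map_zpow (MonoidHom.mk' (fun g : G => ⁅g, x⁆)
    fun g h => commutatorElement_mul_left_of_mem_center hc g h x) g n

theorem commutatorElement_mul_right_of_mem_center
    (hc : ∀ g h : G, ⁅g, h⁆ ∈ Subgroup.center G) (x g h : G) : ⁅x, g * h⁆ = ⁅x, g⁆ * ⁅x, h⁆ := by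
  rw [← commutatorElement_inv, commutatorElement_mul_left_of_mem_center hc, mul_inv_rev,
    commutatorElement_inv, commutatorElement_inv, Subgroup.mem_center_iff.mp (hc x g)]

theorem commutatorElement_zpow_right_of_mem_center
    (hc : ∀ g h : G, ⁅g, h⁆ ∈ Subgroup.center G) (x g : G) (n : ℤ) : ⁅x, g ^ n⁆ = ⁅x, g⁆ ^ n :=
  map_zpow (MonoidHom.mk' (fun g : G => ⁅x, g⁆)
    fun g h => commutatorElement_mul_right_of_mem_center hc x g h) g n

theorem mul_eq_commutatorElement_mul_mul (g h : G) : g * h = ⁅g, h⁆ * (h * g) := by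
  rw [commutatorElement_def]; group

theorem mul_pow_of_commutatorElement_mem_center
    (hc : ∀ g h : G, ⁅g, h⁆ ∈ Subgroup.center G) (x y : G) (n : ℕ) :
    (x * y) ^ n = x ^ n * y ^ n * ⁅y, x⁆ ^ n.choose 2 := by
  induction n with
  | zero => simp
  | succ n ih =>
    have hz : ∀ (k : ℕ) (g : G), g * ⁅y, x⁆ ^ k = ⁅y, x⁆ ^ k * g := fun k =>
      Subgroup.mem_center_iff.mp (pow_mem (hc y x) k)
    have hyx : y ^ n * x = ⁅y, x⁆ ^ n * (x * y ^ n) := by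
      rw [mul_eq_commutatorElement_mul_mul]
      have := commutatorElement_zpow_left_of_mem_center hc y x n
      rw [zpow_natCast, zpow_natCast] at this
      rw [this]
    have hchoose : (n + 1).choose 2 = n + n.choose 2 := by
      rw [Nat.choose_succ_succ' n 1, Nat.choose_one_right]
    calc (x * y) ^ (n + 1) = x ^ n * y ^ n * (⁅y, x⁆ ^ n.choose 2 * (x * y)) := by
          rw [pow_succ, ih, mul_assoc]
      _ = x ^ n * (y ^ n * x) * y * ⁅y, x⁆ ^ n.choose 2 := by
          rw [← hz]; simp only [mul_assoc]
      _ = x ^ n * (x * y ^ n) * y * (⁅y, x⁆ ^ n * ⁅y, x⁆ ^ n.choose 2) := by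
          rw [hyx, ← hz]
          simp only [mul_assoc]
          rw [← mul_assoc y, hz n y]
          simp only [mul_assoc]
      _ = _ := by
          rw [← pow_add, ← hchoose, pow_succ x, pow_succ y]; simp only [mul_assoc]

theorem mul_pow_of_odd_of_commutatorElement_pow_eq_one
    (hc : ∀ g h : G, ⁅g, h⁆ ∈ Subgroup.center G) {q : ℕ} (hq : Odd q) {x y : G}
    (h : ⁅y, x⁆ ^ q = 1) : (x * y) ^ q = x ^ q * y ^ q := by
  obtain ⟨j, rfl⟩ := hq
  have hchoose : (2 * j + 1).choose 2 = (2 * j + 1) * j := by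
    rw [Nat.choose_two_right, Nat.add_sub_cancel, mul_left_comm, Nat.mul_div_cancel_left _ two_pos]
  rw [mul_pow_of_commutatorElement_mem_center hc, hchoose, pow_mul, h, one_pow, mul_one]

/-- In a group of class at most two, if every `⁅g, b⁆` is a power of `⁅a, b⁆`, and `⁅a, b⁆` has odd
order `q` with `b ^ q = 1`, then the transvection `a ↦ a * b`, `b ↦ b` (up to central factors)
extends to an automorphism. -/
theorem exists_mulAut_eq_mul_zpow_mul [Finite G]
    (hc : ∀ g h : G, ⁅g, h⁆ ∈ Subgroup.center G) {a b : G} (hodd : Odd (orderOf ⁅a, b⁆))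
    (hb : b ^ orderOf ⁅a, b⁆ = 1) (hgen : ∀ g : G, ⁅g, b⁆ ∈ Subgroup.zpowers ⁅a, b⁆) :
    ∃ φ : MulAut G, ∀ g : G, ∃ k : ℤ, ⁅a, b⁆ ^ k = ⁅g, b⁆ ∧
      ∃ w ∈ Subgroup.center G, φ g = g * b ^ k * w := by
  choose k hk using hgen
  obtain ⟨j, hj⟩ := hodd
  set z := ⁅a, b⁆
  have hz : ∀ (n : ℤ) (g : G), g * z ^ n = z ^ n * g := fun n =>
    Subgroup.mem_center_iff.mp (zpow_mem (hc a b) n)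
  have hkadd (g h : G) : k (g * h) ≡ k g + k h [ZMOD orderOf z] := by
    rw [← zpow_eq_zpow_iff_modEq, zpow_add]
    have := commutatorElement_mul_left_of_mem_center hc g h b
    rw [← hk, ← hk, ← hk] at this
    exact this
  have hbz {m n : ℤ} (hmn : m ≡ n [ZMOD orderOf z]) : b ^ m = b ^ n :=
    zpow_eq_zpow_iff_modEq.mpr
      (hmn.of_dvd (Int.natCast_dvd_natCast.mpr (orderOf_dvd_of_pow_eq_one hb)))
  have hswap (g : G) (n : ℤ) : b ^ n * g = g * b ^ n * z ^ (-(k g * n)) := by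
    have h1 : ⁅g, b ^ n⁆ = z ^ (k g * n) := by
      rw [commutatorElement_zpow_right_of_mem_center hc, ← hk, zpow_mul]
    rw [mul_eq_commutatorElement_mul_mul g, h1, hz, ← mul_assoc, ← zpow_add, neg_add_cancel,
      zpow_zero, one_mul]
  let f : G →* G := MonoidHom.mk' (fun g => g * b ^ k g * z ^ (j * k g ^ 2)) (by
    intro g h
    have hmod : (j : ℤ) * k (g * h) ^ 2 ≡ j * k g ^ 2 + j * k h ^ 2 + -(k h * k g)
        [ZMOD orderOf z] := by
      refine (((hkadd g h).pow 2).mul_left j).trans ?_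
      rw [hj]
      refine Int.modEq_iff_dvd.mpr ⟨-(k g * k h), ?_⟩
      push_cast
      ring
    calc g * h * b ^ k (g * h) * z ^ (j * k (g * h) ^ 2)
        = g * h * (b ^ k g * b ^ k h) *
            (z ^ (-(k h * k g)) * (z ^ (j * k g ^ 2) * z ^ (j * k h ^ 2))) := by
          rw [hbz (hkadd g h), zpow_eq_zpow_iff_modEq.mpr hmod, zpow_add b,
            ← zpow_add z (j * k g ^ 2), add_comm _ (-(k h * k g)), zpow_add z]
      _ = g * (h * b ^ k g * z ^ (-(k h * k g))) * b ^ k h *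
            (z ^ (j * k g ^ 2) * z ^ (j * k h ^ 2)) := by
          simp only [mul_assoc]
          rw [← mul_assoc (b ^ k h) (z ^ (-(k h * k g))), hz]
          simp only [mul_assoc]
      _ = g * (b ^ k g * h) * b ^ k h * (z ^ (j * k g ^ 2) * z ^ (j * k h ^ 2)) := by
          rw [← hswap]
      _ = g * b ^ k g * z ^ (j * k g ^ 2) * (h * b ^ k h * z ^ (j * k h ^ 2)) := by
          simp only [mul_assoc]
          rw [← mul_assoc (z ^ _) h, ← hz _ h, mul_assoc h, ← mul_assoc (z ^ _) (b ^ k h),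
            ← hz _ (b ^ k h)]
          simp only [mul_assoc])
  have hinj : Function.Injective f := by
    rw [injective_iff_map_eq_one]
    intro g hg
    have hg' : g * b ^ k g * z ^ (j * k g ^ 2) = 1 := hg
    have hcomm : ⁅g, b⁆ = 1 := by
      rw [commutatorElement_eq_one_iff_commute]
      have hg2 : g = (b ^ k g * z ^ (j * k g ^ 2))⁻¹ :=
        eq_inv_of_mul_eq_one_left (by rw [← mul_assoc]; exact hg')
      rw [hg2]
      refine Commute.inv_left (Commute.mul_left ((Commute.refl b).zpow_left _) ?_)
      exact (hz _ b).symm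
    have hk0 : k g ≡ 0 [ZMOD orderOf z] := by
      rw [← zpow_eq_zpow_iff_modEq, zpow_zero]
      exact (hk g).trans hcomm
    have hk0' : (j : ℤ) * k g ^ 2 ≡ 0 [ZMOD orderOf z] := by
      simpa using (hk0.pow 2).mul_left (j : ℤ)
    rwa [hbz hk0, zpow_eq_zpow_iff_modEq.mpr hk0', zpow_zero, zpow_zero, mul_one, mul_one] at hg'
  exact ⟨MulEquiv.ofBijective f (Finite.injective_iff_bijective.mp hinj), fun g =>
    ⟨k g, hk g, _, zpow_mem (hc a b) _, rfl⟩⟩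

end ClassTwo

section Miller

variable {G : Type*} [Group G]

theorem inv_mul_apply_mem_center_of_mulAut_comm (hA : ∀ φ ψ : MulAut G, φ * ψ = ψ * φ)
    (φ : MulAut G) (g : G) : g⁻¹ * φ g ∈ Subgroup.center G := by
  rw [Subgroup.mem_center_iff]
  intro x
  obtain ⟨y, rfl⟩ := φ.surjective x
  have h := DFunLike.congr_fun (hA φ (MulAut.conj g)) y
  simp only [MulAut.mul_apply, MulAut.conj_apply, map_mul, map_inv] at h
  calc φ y * (g⁻¹ * φ g) = g⁻¹ * (g * φ y * g⁻¹) * φ g := by group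
    _ = g⁻¹ * φ g * φ y := by rw [← h]; group

theorem commutatorElement_mem_center_of_mulAut_comm (hA : ∀ φ ψ : MulAut G, φ * ψ = ψ * φ)
    (g h : G) : ⁅g, h⁆ ∈ Subgroup.center G := by
  have := inv_mul_apply_mem_center_of_mulAut_comm hA (MulAut.conj g) h
  rw [MulAut.conj_apply] at this
  rw [commutatorElement_def]
  have h2 := Subgroup.Normal.conj_mem inferInstance _ this h
  convert h2 using 1
  group

end Miller

/-- If `G` is a Miller `p`-group with `p` odd, then `Z(G) ∩ Φ(G)` is not cyclic. -/
theorem miller_pGroup_center_inf_frattini_not_cyclic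
    (p : ℕ) (hp : p.Prime) (hodd : Odd p)
    (G : Type*) [Group G] (hG : IsMiller G) (hpG : IsPGroup p G) :
    ¬ IsCyclic ↥(Subgroup.center G ⊓ frattini G) := by
  intro hcyc
  obtain ⟨hfin, ⟨a₀, b₀, hab₀⟩, hA⟩ := hG
  have := Fact.mk hp
  have hc := commutatorElement_mem_center_of_mulAut_comm hA
  have hmemC (g h : G) : ⁅g, h⁆ ∈ Subgroup.center G ⊓ frattini G :=
    ⟨hc g h, hpG.commutatorElement_mem_frattini hp g h⟩
  have hdvd (x y : G) : orderOf x ∣ orderOf y ∨ orderOf y ∣ orderOf x := by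
    obtain ⟨m, hm⟩ := hpG.exists_orderOf_eq_pow x
    obtain ⟨n, hn⟩ := hpG.exists_orderOf_eq_pow y
    rw [hm, hn]
    exact (le_total m n).imp (pow_dvd_pow p) (pow_dvd_pow p)
  obtain ⟨⟨a₁, b₁⟩, hmax⟩ := Finite.exists_max fun x : G × G => orderOf ⁅x.1, x.2⁆
  set q := orderOf ⁅a₁, b₁⁆ with hq
  have hdvdq (g h : G) : orderOf ⁅g, h⁆ ∣ q := by
    rcases hdvd ⁅g, h⁆ ⁅a₁, b₁⁆ with h1 | h1
    · exact h1
    · exact (le_antisymm (hmax (g, h)) (Nat.le_of_dvd (orderOf_pos _) h1)).dvd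
  have hpowq (g h : G) : ⁅g, h⁆ ^ q = 1 := orderOf_dvd_iff_pow_eq_one.mp (hdvdq g h)
  have hq1 : q ≠ 1 := fun h1 => hab₀ <| commutatorElement_eq_one_iff_mul_comm.mp <| by
    simpa [h1] using hpowq a₀ b₀
  obtain ⟨m, hm⟩ := hpG.exists_orderOf_eq_pow ⁅a₁, b₁⁆
  have hqodd : Odd q := by rw [hq, hm]; exact hodd.pow
  have hpq : p ∣ q := by
    rw [hq, hm]
    exact dvd_pow_self p (by rintro rfl; exact hq1 (by rw [hq, hm, pow_zero]))
  have hpowC (g : G) : g ^ q ∈ Subgroup.center G ⊓ frattini G := by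
    refine ⟨Subgroup.mem_center_iff.mpr fun h => ?_, ?_⟩
    · have := commutatorElement_zpow_right_of_mem_center hc h g q
      rw [zpow_natCast, zpow_natCast, hpowq] at this
      exact commutatorElement_eq_one_iff_mul_comm.mp this
    · obtain ⟨r, hr⟩ := hpq
      rw [hr, pow_mul]
      exact pow_mem (hpG.pow_mem_frattini hp g) r
  have hreduce (a b : G) (h : orderOf (b ^ q) ∣ orderOf (a ^ q)) :
      ∃ b' : G, ⁅a, b'⁆ = ⁅a, b⁆ ∧ b' ^ q = 1 := by
    obtain ⟨k, hk⟩ := Subgroup.mem_zpowers_of_isCyclic_of_orderOf_dvd (hpowC a) (hpowC b) h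
    refine ⟨b * a ^ (-k), ?_, ?_⟩
    · rw [commutatorElement_mul_right_of_mem_center hc,
        commutatorElement_zpow_right_of_mem_center hc, commutatorElement_self, one_zpow, mul_one]
    · rw [mul_pow_of_odd_of_commutatorElement_pow_eq_one hc hqodd (hpowq _ _), ← hk,
        ← zpow_natCast (a ^ (-k)), ← zpow_mul, mul_comm (-k), zpow_mul, zpow_natCast]
      simp
  obtain ⟨a, b, hab, hb⟩ : ∃ a b : G, orderOf ⁅a, b⁆ = q ∧ b ^ q = 1 := by
    rcases hdvd (b₁ ^ q) (a₁ ^ q) with h | h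
    · obtain ⟨b', h1, h2⟩ := hreduce a₁ b₁ h
      exact ⟨a₁, b', by rw [h1], h2⟩
    · obtain ⟨b', h1, h2⟩ := hreduce b₁ a₁ h
      exact ⟨b₁, b', by rw [h1, ← commutatorElement_inv, orderOf_inv], h2⟩
  obtain ⟨φ, hφ⟩ := exists_mulAut_eq_mul_zpow_mul hc (hab ▸ hqodd) (hab ▸ hb) fun g =>
    Subgroup.mem_zpowers_of_isCyclic_of_orderOf_dvd (hmemC a b) (hmemC g b) (hab ▸ hdvdq g b)
  obtain ⟨k, hk, w, hw, hφa⟩ := hφ a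
  have hcen := inv_mul_apply_mem_center_of_mulAut_comm hA φ a
  rw [hφa, mul_assoc, inv_mul_cancel_left, Subgroup.mul_mem_cancel_right _ hw] at hcen
  have h1 : ⁅a, b ^ k⁆ = 1 :=
    commutatorElement_eq_one_iff_mul_comm.mpr (Subgroup.mem_center_iff.mp hcen a)
  rw [commutatorElement_zpow_right_of_mem_center hc, hk] at h1
  exact hq1 (by rw [← hab, h1, orderOf_one])
end

section
/- Let p be an odd prime and let G be a finite p-group of nilpotency class exactly 2, and let p^e be the exponent of the commutator subgroup [G,G]. If the subgroup of [G,G] generated by {x^{p^{e-1}} : x ∈ [G,G]} is cyclic (equivalently, [G,G] has only one cyclic factor of maximal order in its decomposition into cyclic groups), then G possesses a non-central automorphism: there exist an automorphism φ of G and an element g ∈ G with g⁻¹·φ(g) ∉ Z(G). -/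
open scoped commutatorElement IsMulCommutative

section ClassTwo

variable {G : Type*} [Group G]

lemma commutatorElement_mem_center (h : commutator G ≤ Subgroup.center G) (x y : G) :
    ⁅x, y⁆ ∈ Subgroup.center G :=
  h (Subgroup.commutator_mem_commutator (Subgroup.mem_top x) (Subgroup.mem_top y))

lemma commute_commutatorElement (h : commutator G ≤ Subgroup.center G) (x y z : G) :
    Commute ⁅x, y⁆ z :=
  (Subgroup.mem_center_iff.1 (commutatorElement_mem_center h x y) z).symm

/-- In a group of class at most two, `y ↦ ⁅x, y⁆` is a homomorphism into the centre. -/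
def commutatorHom (h : commutator G ≤ Subgroup.center G) (x : G) : G →* Subgroup.center G :=
  MonoidHom.mk' (fun y => ⟨⁅x, y⁆, commutatorElement_mem_center h x y⟩) fun y z => by
    ext
    change ⁅x, y * z⁆ = ⁅x, y⁆ * ⁅x, z⁆
    rw [commutatorElement_mul_right_eq_mul_conj,
      mul_assoc ⁅x, y⁆, ← (commute_commutatorElement h x z y).eq]
    group

lemma commutatorElement_zpow_right (h : commutator G ≤ Subgroup.center G) (x y : G) (n : ℤ) :
    ⁅x, y ^ n⁆ = ⁅x, y⁆ ^ n :=
  congrArg Subtype.val (map_zpow (commutatorHom h x) y n)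

lemma commutatorElement_zpow_left (h : commutator G ≤ Subgroup.center G) (x y : G) (n : ℤ) :
    ⁅x ^ n, y⁆ = ⁅x, y⁆ ^ n := by
  rw [← commutatorElement_inv, commutatorElement_zpow_right h, ← inv_zpow, commutatorElement_inv]

lemma commutatorElement_pow_left (h : commutator G ≤ Subgroup.center G) (x y : G) (n : ℕ) :
    ⁅x ^ n, y⁆ = ⁅x, y⁆ ^ n := by
  exact_mod_cast commutatorElement_zpow_left h x y n

lemma commutatorElement_mul_left (h : commutator G ≤ Subgroup.center G) (x y z : G) :
    ⁅x * y, z⁆ = ⁅x, z⁆ * ⁅y, z⁆ := by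
  rw [commutatorElement_mul_left_eq_conj_mul, ← (commute_commutatorElement h y z x).eq,
    mul_inv_cancel_right, (commute_commutatorElement h y z _).eq]

lemma mul_pow_eq_mul_commutatorElement_pow (h : commutator G ≤ Subgroup.center G) (x y : G)
    (n : ℕ) : (x * y) ^ n = x ^ n * y ^ n * ⁅y, x⁆ ^ n.choose 2 := by
  induction n with
  | zero => simp
  | succ n ih =>
    have hyx : y ^ n * x = ⁅y, x⁆ ^ n * x * y ^ n := by
      rw [← commutatorElement_pow_left h, commutatorElement_def]; group
    have hc (k : ℕ) (z : G) : ⁅y, x⁆ ^ k * z = z * ⁅y, x⁆ ^ k :=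
      ((commute_commutatorElement h y x z).pow_left k).eq
    calc (x * y) ^ (n + 1) = x ^ n * y ^ n * (⁅y, x⁆ ^ n.choose 2 * (x * y)) := by
          rw [pow_succ, ih]; group
      _ = x ^ n * (y ^ n * x) * y * ⁅y, x⁆ ^ n.choose 2 := by rw [hc]; group
      _ = x ^ n * (⁅y, x⁆ ^ n * (x * y ^ n * y)) * ⁅y, x⁆ ^ n.choose 2 := by rw [hyx]; group
      _ = x ^ (n + 1) * y ^ (n + 1) * (⁅y, x⁆ ^ n * ⁅y, x⁆ ^ n.choose 2) := by
          rw [hc]; group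
      _ = x ^ (n + 1) * y ^ (n + 1) * ⁅y, x⁆ ^ (n + 1).choose 2 := by
          rw [← pow_add, Nat.choose_succ_succ' n 1, Nat.choose_one_right]

lemma mul_pow_of_exponent_dvd {n : ℕ} (h : commutator G ≤ Subgroup.center G)
    (hn : Monoid.exponent (commutator G) ∣ n) (hodd : Odd n) (x y : G) :
    (x * y) ^ n = x ^ n * y ^ n := by
  obtain ⟨k, rfl⟩ := hodd
  have hc : ⁅y, x⁆ ^ (2 * k + 1) = 1 := by
    have := (Monoid.exponent_dvd_iff_forall_pow_eq_one.1 hn) ⟨⁅y, x⁆,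
      Subgroup.commutator_mem_commutator (Subgroup.mem_top y) (Subgroup.mem_top x)⟩
    simpa [Subtype.ext_iff] using this
  have h2 : (2 * k + 1).choose 2 = (2 * k + 1) * k := by
    rw [Nat.choose_two_right, Nat.add_sub_cancel]
    exact Nat.div_eq_of_eq_mul_left two_pos (by ring)
  rw [mul_pow_eq_mul_commutatorElement_pow h, h2, pow_mul, hc, one_pow, mul_one]

end ClassTwo

/-- A homomorphism from a finite abelian group to `ℤ/p` lifts to a homomorphism to `ℤ/p^(m+1)`
as soon as it vanishes on the elements killed by `p^m`. -/
lemma exists_lift_modEq_prime_pow {A : Type*} [CommGroup A] [Finite A] {p m : ℕ} (hp : p.Prime)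
    (j : A → ℤ) (hj : ∀ a b, j (a * b) ≡ j a + j b [ZMOD p])
    (hker : ∀ a, a ^ p ^ m = 1 → j a ≡ 0 [ZMOD p]) :
    ∃ f : A → ℤ, (∀ a b, f (a * b) ≡ f a + f b [ZMOD p ^ (m + 1)]) ∧
      ∀ a, f a ≡ j a [ZMOD p] := by
  have hp0 : p ≠ 0 := hp.ne_zero
  have : NeZero (p ^ (m + 1)) := ⟨pow_ne_zero _ hp0⟩
  obtain ⟨z, hz⟩ := HasEnoughRootsOfUnity.exists_primitiveRoot ℂ (p ^ (m + 1))
  let ζ : ℂˣ := (hz.isUnit (NeZero.ne _)).unit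
  have hζ : IsPrimitiveRoot ζ (p ^ (m + 1)) := hz.isUnit_unit (NeZero.ne _)
  have hord : orderOf ζ = p ^ (m + 1) := hζ.eq_orderOf.symm
  have hordm : orderOf (ζ ^ p ^ m) = p :=
    (hζ.pow (pow_pos hp.pos _) (pow_succ p m)).eq_orderOf.symm
  let χ : A →* ℂˣ := MonoidHom.mk' (fun a => (ζ ^ p ^ m) ^ j a) fun a b => by
    rw [← zpow_add, zpow_eq_zpow_iff_modEq, hordm]
    exact hj a b
  let π : A →* (powMonoidHom (p ^ m) : A →* A).range :=
    (powMonoidHom (p ^ m) : A →* A).rangeRestrict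
  have hπ : π.ker ≤ χ.ker := fun a ha => by
    rw [MonoidHom.ker_rangeRestrict, MonoidHom.mem_ker] at ha
    rw [MonoidHom.mem_ker]
    change (ζ ^ p ^ m) ^ j a = 1
    rw [← zpow_zero (ζ ^ p ^ m), zpow_eq_zpow_iff_modEq, hordm]
    exact hker a ha
  have hsurj : Function.Surjective π := MonoidHom.rangeRestrict_surjective _
  obtain ⟨ψ, hψ⟩ := MonoidHom.domRestrict_surjective (M := ℂ) _ (π.liftOfSurjective hsurj ⟨χ, hπ⟩)
  have hψχ (a : A) : ψ a ^ p ^ m = χ a := by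
    rw [← map_pow]
    have h1 := DFunLike.congr_fun hψ (π a)
    rw [MonoidHom.liftOfRightInverse_comp_apply] at h1
    exact h1
  have hmem (a : A) : ∃ i : ℤ, ζ ^ i = ψ a := by
    have h1 : ψ a ^ p ^ (m + 1) = 1 := by
      have hordm' := pow_orderOf_eq_one (ζ ^ p ^ m)
      rw [hordm] at hordm'
      rw [pow_succ, pow_mul, hψχ]
      change ((ζ ^ p ^ m) ^ j a) ^ p = 1
      rw [← zpow_natCast, zpow_comm, zpow_natCast, hordm', one_zpow]
    have h2 : ψ a ∈ rootsOfUnity (p ^ (m + 1)) ℂ := (mem_rootsOfUnity _ _).2 h1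
    rw [← hζ.zpowers_eq] at h2
    exact h2
  choose f hf using hmem
  refine ⟨f, fun a b => ?_, fun a => ?_⟩
  · have : ζ ^ f (a * b) = ζ ^ (f a + f b) := by rw [zpow_add, hf, hf, hf, map_mul]
    rw [zpow_eq_zpow_iff_modEq, hord] at this
    exact_mod_cast this
  · have : (ζ ^ p ^ m) ^ f a = (ζ ^ p ^ m) ^ j a := by
      rw [← zpow_natCast, zpow_comm, hf, zpow_natCast, hψχ]; rfl
    rwa [zpow_eq_zpow_iff_modEq, hordm] at this

/-- In a group of class two, the twisted transvection `g ↦ g * u ^ f g * c ^ (s * f g ^ 2)`,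
where `⁅u, g⁆ = c ^ f g` and `2 * s ≡ 1` modulo `p`, is a noncentral automorphism. -/
lemma exists_noncentral_mulAut_of_commutatorElement_eq_zpow {G : Type*} [Group G] [Finite G]
    {p k : ℕ} (hp : p.Prime) (hodd : Odd p) {u c : G} (hu : u ^ p ^ k = 1)
    (hc : orderOf c = p) (hcc : c ∈ Subgroup.center G) (huc : u ∉ Subgroup.center G)
    (f : G → ℤ) (hf : ∀ g h, f (g * h) ≡ f g + f h [ZMOD p ^ k])
    (hfc : f c ≡ 0 [ZMOD p ^ k]) (huf : ∀ g, ⁅u, g⁆ = c ^ f g) :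
    ∃ (φ : MulAut G) (g : G), g⁻¹ * φ g ∉ Subgroup.center G := by
  have hpc (a b : ℤ) : c ^ a = c ^ b ↔ a ≡ b [ZMOD p] := by rw [zpow_eq_zpow_iff_modEq, hc]
  have hcomm (i : ℤ) (g : G) : c ^ i * g = g * c ^ i :=
    (Subgroup.mem_center_iff.1 (zpow_mem hcc i) g).symm
  have huk {a b : ℤ} (hab : a ≡ b [ZMOD p ^ k]) : u ^ a = u ^ b := by
    rw [zpow_eq_zpow_iff_modEq]
    exact hab.of_dvd (by exact_mod_cast orderOf_dvd_of_pow_eq_one hu)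
  obtain ⟨g₀, hg₀⟩ : ∃ g : G, ⁅u, g⁆ ≠ 1 := by
    by_contra! hall
    exact huc (Subgroup.mem_center_iff.2 fun g =>
      (commutatorElement_eq_one_iff_mul_comm.1 (hall g)).symm)
  have hk : k ≠ 0 := by
    rintro rfl
    rw [pow_zero, pow_one] at hu
    exact huc (hu ▸ one_mem _)
  have hdvd : (p : ℤ) ∣ (p : ℤ) ^ k := dvd_pow_self _ hk
  obtain ⟨r, hr⟩ := hodd
  let F : G →* Multiplicative (ZMod (p ^ k)) :=
    MonoidHom.mk' (fun g => Multiplicative.ofAdd (f g : ZMod (p ^ k))) fun g h => by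
      rw [← ofAdd_add, ← Int.cast_add]
      exact congrArg _ ((ZMod.intCast_eq_intCast_iff _ _ _).2 (by exact_mod_cast hf g h))
  have hFzpow (g : G) (i : ℤ) : f (g ^ i) ≡ i * f g [ZMOD p ^ k] := by
    have h1 : (f (g ^ i) : ZMod (p ^ k)) = ((i * f g : ℤ) : ZMod (p ^ k)) := by
      have h2 := congrArg Multiplicative.toAdd (map_zpow F g i)
      rw [toAdd_zpow] at h2
      change (f (g ^ i) : ZMod (p ^ k)) = i • (f g : ZMod (p ^ k)) at h2
      rw [h2]
      push_cast
      rw [zsmul_eq_mul]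
    exact_mod_cast (ZMod.intCast_eq_intCast_iff _ _ _).1 h1
  have hswap (h : G) (i : ℤ) : u ^ i * h = h * u ^ i * c ^ (i * f h) := by
    have h1 : h⁻¹ * u * h = c ^ f h * u := by
      rw [mul_assoc, inv_mul_eq_iff_eq_mul, ← mul_assoc, ← hcomm, ← huf, commutatorElement_def]
      group
    have h2 := conj_zpow (i := i) (a := h⁻¹) (b := u)
    rw [inv_inv, h1, (show Commute (c ^ f h) u from hcomm _ _).mul_zpow, ← zpow_mul] at h2
    rw [mul_assoc, ← hcomm, mul_comm i, h2]
    group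
  let φ : G →* G := MonoidHom.mk' (fun g => g * u ^ f g * c ^ ((r + 1) * f g ^ 2)) fun g h => by
    have h1 : c ^ ((r + 1) * f (g * h) ^ 2) =
        c ^ (f g * f h + (r + 1) * f g ^ 2 + (r + 1) * f h ^ 2) := by
      rw [hpc]
      have h2 : (r + 1) * f (g * h) ^ 2 ≡ (r + 1) * (f g + f h) ^ 2 [ZMOD p] :=
        (((hf g h).of_dvd hdvd).pow 2).mul_left _
      refine h2.trans (Int.modEq_iff_dvd.2 ⟨-(f g * f h), ?_⟩)
      rw [hr]
      push_cast
      ring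
    calc g * h * u ^ f (g * h) * c ^ ((r + 1) * f (g * h) ^ 2)
        = g * h * u ^ (f g + f h) *
          c ^ (f g * f h + (r + 1) * f g ^ 2 + (r + 1) * f h ^ 2) := by
          rw [h1, huk (hf g h)]
      _ = g * (h * u ^ f g * c ^ (f g * f h)) * u ^ f h *
          c ^ ((r + 1) * f g ^ 2) * c ^ ((r + 1) * f h ^ 2) := by
          rw [zpow_add, zpow_add c, zpow_add c]
          simp only [mul_assoc]
          rw [← mul_assoc (c ^ (f g * f h)) (u ^ f h), hcomm _ (u ^ f h)]
          simp only [mul_assoc]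
      _ = g * u ^ f g * h * u ^ f h * c ^ ((r + 1) * f g ^ 2) * c ^ ((r + 1) * f h ^ 2) := by
          rw [← hswap]; simp only [mul_assoc]
      _ = g * u ^ f g * c ^ ((r + 1) * f g ^ 2) * (h * u ^ f h * c ^ ((r + 1) * f h ^ 2)) := by
          simp only [mul_assoc]
          rw [← mul_assoc (c ^ ((r + 1) * f g ^ 2)) h, hcomm _ h]
          simp only [mul_assoc]
          rw [← mul_assoc (c ^ ((r + 1) * f g ^ 2)) (u ^ f h), hcomm _ (u ^ f h)]
          simp only [mul_assoc]
  have hφ (g : G) : φ g = g * u ^ f g * c ^ ((r + 1) * f g ^ 2) := rfl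
  have hprime : Prime (p : ℤ) := Nat.prime_iff_prime_int.1 hp
  have hfu : (p : ℤ) ∣ f u := by
    have h1 := huf u
    rw [commutatorElement_self, ← zpow_zero c, hpc] at h1
    exact (Int.modEq_zero_iff_dvd).1 h1.symm
  have hf1 : f 1 ≡ 0 [ZMOD p ^ k] := by simpa using hFzpow 1 0
  have hinj : Function.Injective φ := (injective_iff_map_eq_one φ).2 fun g hg => by
    have h1 : f g * (1 + f u) ≡ 0 [ZMOD p ^ k] := by
      have h2 : f (φ g) ≡ f g + f g * f u + (r + 1) * f g ^ 2 * f c [ZMOD p ^ k] := by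
        rw [hφ]
        exact (hf _ _).trans (((hf _ _).trans ((hFzpow u _).add_left _)).add (hFzpow c _))
      rw [hg] at h2
      have h3 := (h2.symm.trans hf1).symm.trans
        ((hfc.mul_left ((r + 1) * f g ^ 2)).add_left (f g + f g * f u))
      simpa [mul_add] using h3.symm
    have hcop : IsCoprime ((p : ℤ) ^ k) (1 + f u) := by
      refine IsCoprime.pow_left ((Prime.coprime_iff_not_dvd hprime).2 fun hd => ?_)
      exact hprime.not_dvd_one ((Int.dvd_add_left hfu).1 hd)
    have hg0 : f g ≡ 0 [ZMOD p ^ k] :=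
      Int.modEq_zero_iff_dvd.2 (hcop.dvd_of_dvd_mul_right (Int.modEq_zero_iff_dvd.1 h1))
    have hg2 : c ^ ((r + 1) * f g ^ 2) = c ^ (0 : ℤ) := by
      rw [hpc]
      simpa using ((hg0.of_dvd hdvd).pow 2).mul_left ((r : ℤ) + 1)
    rw [hφ, huk hg0, hg2] at hg
    simpa using hg
  refine ⟨MulEquiv.ofBijective φ (Finite.injective_iff_bijective.1 hinj), g₀, fun hmem => ?_⟩
  rw [MulEquiv.ofBijective_apply, hφ, mul_assoc, inv_mul_cancel_left,
    Subgroup.mul_mem_cancel_right _ (zpow_mem hcc _)] at hmem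
  have hcop : IsCoprime ((p : ℤ) ^ k) (f g₀) := by
    refine IsCoprime.pow_left ((Prime.coprime_iff_not_dvd hprime).2 fun hd => hg₀ ?_)
    rw [huf, ← zpow_zero c, hpc]
    exact Int.modEq_zero_iff_dvd.2 hd
  obtain ⟨a, b, hab⟩ := hcop
  refine huc ?_
  have h1 : u = (u ^ f g₀) ^ b := by
    rw [← zpow_mul, mul_comm, ← zpow_one u, ← zpow_mul, one_mul]
    refine huk (Int.modEq_iff_dvd.2 ⟨-a, ?_⟩)
    linear_combination hab
  rw [h1]
  exact zpow_mem hmem b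


/-- Adney–Yen: a finite `p`-group (`p` odd) of class exactly `2` whose commutator
subgroup has only one cyclic factor of maximal order (equivalently, the subgroup of
`[G,G]` generated by the `p^(e-1)`-th powers is cyclic, where `p^e = exp [G,G]`)
possesses a non-central automorphism. -/
theorem pGroup_one_maximal_cyclic_factor_noncentral_aut
    (p : ℕ) (hp : p.Prime) (hodd : Odd p)
    (G : Type*) [Group G] [Finite G] (hpG : IsPGroup p G)
    (hclass : commutator G ≤ Subgroup.center G)
    (hnonab : commutator G ≠ ⊥)
    (e : ℕ) (he : Monoid.exponent ↥(commutator G) = p ^ e)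
    (hcyc : IsCyclic ↥(Subgroup.closure
      ((fun x : G => x ^ p ^ (e - 1)) '' (commutator G : Set G)))) :
    ∃ (φ : MulAut G) (g : G), g⁻¹ * φ g ∉ Subgroup.center G := by
  have he0 : e ≠ 0 := by
    rintro rfl
    rw [pow_zero, Monoid.exp_eq_one_iff] at he
    exact hnonab ((Subgroup.eq_bot_iff_forall _).2 fun x hx =>
      congrArg Subtype.val (Subsingleton.elim (⟨x, hx⟩ : commutator G) 1))
  have hee : e - 1 + 1 = e := by omega
  set q := p ^ (e - 1) with hq
  set C := Subgroup.closure ((fun x : G => x ^ q) '' (commutator G : Set G)) with hC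
  have hexp {x : G} (hx : x ∈ commutator G) : x ^ p ^ e = 1 := by
    simpa [he, Subtype.ext_iff] using Monoid.pow_exponent_eq_one (⟨x, hx⟩ : commutator G)
  have hmemC {x : G} (hx : x ∈ commutator G) : x ^ q ∈ C :=
    Subgroup.subset_closure ⟨x, hx, rfl⟩
  have hbr (x y : G) : ⁅x, y⁆ ∈ commutator G :=
    Subgroup.commutator_mem_commutator (Subgroup.mem_top x) (Subgroup.mem_top y)
  have hCle : C ≤ commutator G := by
    rw [hC, Subgroup.closure_le]
    rintro _ ⟨x, hx, rfl⟩
    exact pow_mem hx _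
  have hCpow {z : G} (hz : z ∈ C) : z ^ p = 1 := by
    induction hz using Subgroup.closure_induction with
    | mem z hz =>
      obtain ⟨x, hx, rfl⟩ := hz
      change (x ^ q) ^ p = 1
      rw [← pow_mul, hq, ← pow_succ, hee, hexp hx]
    | one => exact one_pow p
    | mul y z hy hz hy1 hz1 =>
      have hcom : Commute y z := (Subgroup.mem_center_iff.1 (hclass (hCle hy)) z).symm
      rw [hcom.mul_pow, hy1, hz1, one_mul]
    | inv y hy hy1 => rw [inv_pow, hy1, inv_one]
  obtain ⟨x₀, y₀, h₀⟩ : ∃ x y : G, ⁅x, y⁆ ^ q ≠ 1 := by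
    by_contra! hall
    have h1 : ∀ z ∈ commutator G, z ^ q = 1 := fun z hz => by
      rw [commutator_eq_closure] at hz
      induction hz using Subgroup.closure_induction with
      | mem z hz =>
        obtain ⟨x, y, rfl⟩ := hz
        exact hall x y
      | one => exact one_pow q
      | mul y z hy hz hy1 hz1 =>
        rw [← commutator_eq_closure] at hy
        have hcom : Commute y z := (Subgroup.mem_center_iff.1 (hclass hy) z).symm
        rw [hcom.mul_pow, hy1, hz1, one_mul]
      | inv y hy hy1 => rw [inv_pow, hy1, inv_one]
    have h2 : p ^ e ∣ p ^ (e - 1) := by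
      rw [← he, Monoid.exponent_dvd_iff_forall_pow_eq_one]
      exact fun z => Subtype.ext (h1 z z.2)
    have := (Nat.pow_dvd_pow_iff_le_right hp.one_lt).1 h2
    omega
  obtain ⟨⟨c, hcC⟩, hcgen⟩ := hcyc
  have hzp {z : G} (hz : z ∈ C) : ∃ i : ℤ, c ^ i = z := by
    obtain ⟨i, hi⟩ := hcgen ⟨z, hz⟩
    exact ⟨i, congrArg Subtype.val hi⟩
  have hc1 : c ≠ 1 := by
    rintro rfl
    obtain ⟨i, hi⟩ := hzp (hmemC (hbr x₀ y₀))
    exact h₀ (by rw [← hi, one_zpow])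
  have : Fact p.Prime := ⟨hp⟩
  have hc : orderOf c = p := orderOf_eq_prime (hCpow hcC) hc1
  have hpc (a b : ℤ) : c ^ a = c ^ b ↔ a ≡ b [ZMOD p] := by rw [zpow_eq_zpow_iff_modEq, hc]
  have hgen {y z : G} (hy : y ∈ C) (hy1 : y ≠ 1) (hz : z ∈ C) : ∃ i : ℤ, y ^ i = z := by
    have hcard : Nat.card (Subgroup.zpowers c) = p := by rw [Nat.card_zpowers, hc]
    have h1 := mem_zpowers_of_prime_card hcard (g := (⟨y, hzp hy⟩ : Subgroup.zpowers c))
      (g' := ⟨z, hzp hz⟩) (fun h => hy1 (congrArg Subtype.val h))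
    obtain ⟨i, hi⟩ := h1
    exact ⟨i, congrArg Subtype.val hi⟩
  have hnoncentral {x y : G} (h : ⁅x ^ q, y⁆ ≠ 1) : x ^ q ∉ Subgroup.center G := fun hx =>
    h (commutatorElement_eq_one_iff_mul_comm.2 (Subgroup.mem_center_iff.1 hx y).symm)
  -- We work with the least `n` such that some `x` with `x ^ q` noncentral has `x ^ p ^ n = 1`.
  have hex : ∃ n, ∃ x : G, x ^ q ∉ Subgroup.center G ∧ x ^ p ^ n = 1 := by
    obtain ⟨n, hn⟩ := hpG x₀
    refine ⟨n, x₀, hnoncentral (y := y₀) ?_, hn⟩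
    rwa [commutatorElement_pow_left hclass]
  obtain ⟨n, ⟨x₁, hx₁, hx₁n⟩, hmin⟩ : ∃ n, (∃ x : G, x ^ q ∉ Subgroup.center G ∧ x ^ p ^ n = 1) ∧
      ∀ m < n, ∀ x : G, x ^ p ^ m = 1 → x ^ q ∈ Subgroup.center G := by
    classical
    refine ⟨Nat.find hex, Nat.find_spec hex, fun m hm x hx => ?_⟩
    by_contra hxc
    exact Nat.find_min hex hm ⟨x, hxc, hx⟩
  have hen : e ≤ n := by
    by_contra! hlt
    refine hx₁ ?_
    have hle : n ≤ e - 1 := by omega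
    rw [hq, ← Nat.sub_add_cancel hle, add_comm, pow_add, pow_mul, hx₁n, one_pow]
    exact one_mem _
  obtain ⟨m, rfl⟩ : ∃ m, n = e + m := ⟨n - e, by omega⟩
  have hfinish {x : G} (hx : x ^ q ∉ Subgroup.center G) (hxn : x ^ p ^ (e + m) = 1)
      (hgood : ∀ a, a ^ p ^ m ∈ commutator G → ⁅x ^ q, a⁆ = 1) :
      ∃ (φ : MulAut G) (g : G), g⁻¹ * φ g ∉ Subgroup.center G := by
    let L : Abelianization G →* Subgroup.center G :=
      Abelianization.lift (A := Subgroup.center G) (commutatorHom hclass (x ^ q))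
    have hL (g : G) : (L (Abelianization.of g) : G) = ⁅x ^ q, g⁆ := rfl
    have hsurj : Function.Surjective (Abelianization.of : G →* Abelianization G) :=
      QuotientGroup.mk_surjective
    have hj (a : Abelianization G) : ∃ i : ℤ, c ^ i = L a := by
      obtain ⟨g, rfl⟩ := hsurj a
      rw [hL, commutatorElement_pow_left hclass]
      exact hzp (hmemC (hbr x g))
    choose j hj using hj
    obtain ⟨f, hf, hfj⟩ := exists_lift_modEq_prime_pow (m := m) hp j
      (fun a b => by rw [← hpc, zpow_add, hj, hj, hj, map_mul]; rfl)
      (fun a ha => by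
        obtain ⟨g, rfl⟩ := hsurj a
        rw [← map_pow, ← MonoidHom.mem_ker, Abelianization.ker_of] at ha
        rw [← hpc, hj, hL, hgood g ha, zpow_zero])
    have hcof : Abelianization.of c = 1 := by
      rw [← MonoidHom.mem_ker, Abelianization.ker_of]
      exact hCle hcC
    refine exists_noncentral_mulAut_of_commutatorElement_eq_zpow (u := x ^ q) (c := c)
      (k := m + 1) hp hodd ?_ hc (hclass (hCle hcC)) hx (fun g => f (Abelianization.of g))
      (fun g h => by simpa using hf (Abelianization.of g) (Abelianization.of h)) ?_ fun g => ?_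
    · rw [← pow_mul, hq, ← pow_add]
      convert hxn using 3
      omega
    · have h1 := (hf 1 1).add_right (-f 1)
      simp only [mul_one, add_neg_cancel, add_neg_cancel_right] at h1
      simpa only [hcof] using h1.symm
    · rw [← hL, ← hj, hpc]
      exact (hfj _).symm
  by_contra hcon
  have hbad {x : G} (hx : x ^ q ∉ Subgroup.center G) (hxn : x ^ p ^ (e + m) = 1) :
      ∃ a, a ^ p ^ m ∈ commutator G ∧ ⁅x ^ q, a⁆ ≠ 1 := by
    by_contra! hgood
    exact hcon (hfinish hx hxn hgood)
  have hm0 : m ≠ 0 := by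
    rintro rfl
    obtain ⟨a, ha, hxa⟩ := hbad hx₁ hx₁n
    rw [pow_zero, pow_one] at ha
    exact hxa (commutatorElement_eq_one_iff_mul_comm.2 (Subgroup.mem_center_iff.1 (hclass ha) _))
  have hpred (a : G) : a ^ p ^ (e + m - 1) = (a ^ p ^ m) ^ q := by
    rw [← pow_mul, hq, ← pow_add]
    congr 2
    omega
  obtain ⟨a, ha, hxa⟩ := hbad hx₁ hx₁n
  have haq : a ^ q ∉ Subgroup.center G := by
    refine hnoncentral (y := x₁) fun h => hxa ?_
    rw [commutatorElement_pow_left hclass] at h ⊢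
    rw [← commutatorElement_inv, inv_pow, h, inv_one]
  have han : a ^ p ^ (e + m) = 1 := by rw [add_comm, pow_add, pow_mul, hexp ha]
  obtain ⟨b, hb, hab⟩ := hbad haq han
  have haC : a ^ p ^ (e + m - 1) ∈ C := hpred a ▸ hmemC ha
  have hbC : b ^ p ^ (e + m - 1) ∈ C := hpred b ▸ hmemC hb
  have ha1 : a ^ p ^ (e + m - 1) ≠ 1 := fun h => haq (hmin _ (by omega) a h)
  obtain ⟨i, hi⟩ := hgen haC ha1 hbC
  have hone : (a ^ (-i) * b) ^ p ^ (e + m - 1) = 1 := by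
    rw [mul_pow_of_exponent_dvd hclass (he ▸ pow_dvd_pow p (by omega)) hodd.pow, ← hi,
      ← zpow_natCast, zpow_comm, zpow_natCast, ← zpow_add, neg_add_cancel, zpow_zero]
  have hcen := hmin _ (by omega) _ hone
  refine hab ?_
  have h1 : ⁅(a ^ (-i) * b) ^ q, a⁆ = 1 :=
    commutatorElement_eq_one_iff_mul_comm.2 (Subgroup.mem_center_iff.1 hcen a).symm
  rw [commutatorElement_pow_left hclass, commutatorElement_mul_left hclass,
    commutatorElement_zpow_left hclass, commutatorElement_self, one_zpow, one_mul] at h1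
  rw [commutatorElement_pow_left hclass, ← commutatorElement_inv, inv_pow, h1, inv_one]
end

section
/- If p is a prime and G is a Miller p-group, then every generating set of G has at least 3 elements; equivalently, the minimal cardinality of a generating set of G is at least 3. -/
section

variable {G : Type*} [Group G]

/-- If `G = N⟨a⟩` and `u ∈ Z(N)` is such that powers of `a` lying in `N` are unchanged when `a` is
replaced by `a * u`, then some automorphism (the identity on `N`) maps `a` to `a * u`. -/
theorem exists_mulAut_mul_right [Finite G] (N : Subgroup G) [N.Normal] {a u : G}
    (ha : ∀ x : G, ∃ t : ℤ, x * a ^ (-t) ∈ N) (huN : u ∈ N)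
    (hu : u ∈ Subgroup.centralizer (N : Set G))
    (h : ∀ t : ℤ, a ^ t ∈ N → (a * u) ^ t = a ^ t) :
    ∃ φ : MulAut G, φ a = a * u := by
  choose e he using ha
  have key : ∀ m ∈ N, ∀ t : ℤ,
      m * a ^ t * a ^ (-e (m * a ^ t)) * (a * u) ^ e (m * a ^ t) = m * (a * u) ^ t := by
    intro m hm t
    have h1 := he (m * a ^ t)
    generalize e (m * a ^ t) = s at h1 ⊢
    have h2 : a ^ (t - s) ∈ N := by
      have := N.mul_mem (N.inv_mem hm) h1
      rwa [show m⁻¹ * (m * a ^ t * a ^ (-s)) = a ^ (t - s) by group] at this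
    have h3 := h _ h2
    calc _ = m * a ^ (t - s) * (a * u) ^ s := by group
      _ = m * (a * u) ^ (t - s) * (a * u) ^ s := by rw [h3]
      _ = _ := by rw [mul_assoc, ← zpow_add, sub_add_cancel]
  have hconj : ∀ t : ℤ, a ^ (-t) * (a * u) ^ t ∈ Subgroup.centralizer (N : Set G) := by
    intro t
    rw [zpow_neg, ← QuotientGroup.eq, QuotientGroup.mk_zpow, QuotientGroup.mk_zpow,
      QuotientGroup.mk_mul_of_mem a hu]
  have hmodN : ∀ t : ℤ, a ^ (-t) * (a * u) ^ t ∈ N := by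
    intro t
    rw [zpow_neg, ← QuotientGroup.eq, QuotientGroup.mk_zpow, QuotientGroup.mk_zpow,
      QuotientGroup.mk_mul_of_mem a huN]
  have hdec : ∀ x : G, ∃ m ∈ N, ∃ t : ℤ, x = m * a ^ t := fun x ↦
    ⟨_, he x, e x, by group⟩
  let f : G →* G := MonoidHom.mk' (fun x ↦ x * a ^ (-e x) * (a * u) ^ e x) (by
    intro x y
    obtain ⟨m, hm, t, rfl⟩ := hdec x
    obtain ⟨n, hn, s, rfl⟩ := hdec y
    have hn' : a ^ t * n * a ^ (-t) ∈ N := by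
      rw [zpow_neg]; exact ‹N.Normal›.conj_mem n hn _
    have e1 : m * a ^ t * (n * a ^ s) = m * (a ^ t * n * a ^ (-t)) * a ^ (t + s) := by group
    simp only [e1, key m hm t, key n hn s, key _ (N.mul_mem hm hn')]
    have h2 := Subgroup.mem_centralizer_iff.1 (hconj t) n hn
    have h3 : (a * u) ^ t = a ^ t * (a ^ (-t) * (a * u) ^ t) := by group
    generalize a ^ (-t) * (a * u) ^ t = w at h2 h3
    rw [zpow_add, h3]
    calc _ = m * a ^ t * (n * w) * (a * u) ^ s := by group
      _ = _ := by rw [h2]; group)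
  have hf : ∀ m ∈ N, ∀ t : ℤ, f (m * a ^ t) = m * (a * u) ^ t := key
  have hinj : Function.Injective f := by
    rw [injective_iff_map_eq_one]
    intro x hx
    obtain ⟨m, hm, t, rfl⟩ := hdec x
    rw [hf m hm] at hx
    have h1 : (a * u) ^ t ∈ N := by
      rw [← inv_eq_of_mul_eq_one_right hx]; exact N.inv_mem hm
    have h2 : a ^ t ∈ N := by
      have := N.mul_mem h1 (N.inv_mem (hmodN t))
      rwa [show (a * u) ^ t * (a ^ (-t) * (a * u) ^ t)⁻¹ = a ^ t by group] at this
    rw [← h t h2, hx]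
  refine ⟨MulEquiv.ofBijective f (Finite.injective_iff_bijective.1 hinj), ?_⟩
  simpa using hf 1 N.one_mem 1


theorem mul_pow_of_mul_eq {a y w : G} (hw : w ∈ Subgroup.center G) (h : y * a = a * y * w)
    (t : ℕ) : (a * y) ^ t = a ^ t * y ^ t * w ^ t.choose 2 := by
  have hc : ∀ (g : G) (i : ℕ), w ^ i * g = g * w ^ i := fun g i ↦
    (Subgroup.mem_center_iff.1 (Subgroup.pow_mem _ hw i) g).symm
  have hy : ∀ t : ℕ, y ^ t * a = a * y ^ t * w ^ t := by
    intro t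
    induction t with
    | zero => simp
    | succ t ih =>
      calc y ^ (t + 1) * a = y * (y ^ t * a) := by rw [pow_succ', mul_assoc]
        _ = (y * a) * (y ^ t * w ^ t) := by rw [ih]; simp only [mul_assoc]
        _ = a * y * (w ^ 1 * y ^ t) * w ^ t := by rw [h, pow_one]; simp only [mul_assoc]
        _ = _ := by rw [hc, pow_one, pow_succ' y, pow_succ' w]; simp only [mul_assoc]
  induction t with
  | zero => simp
  | succ t ih =>
    calc (a * y) ^ (t + 1) = a ^ t * y ^ t * (w ^ t.choose 2 * (a * y)) := by
          rw [pow_succ, ih]; simp only [mul_assoc]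
      _ = a ^ t * (y ^ t * a) * y * w ^ t.choose 2 := by rw [hc]; simp only [mul_assoc]
      _ = a ^ t * a * y ^ t * (w ^ t * y) * w ^ t.choose 2 := by rw [hy]; simp only [mul_assoc]
      _ = _ := by
        rw [hc, Nat.choose_succ_succ' t 1, Nat.choose_one_right, pow_succ a, pow_succ y, pow_add]
        simp only [mul_assoc]

theorem zpow_mul_eq {a b z : G} (hz : z ∈ Subgroup.center G) (h : b * a = a * b * z) (x : ℤ) :
    b ^ x * a = a * b ^ x * z ^ x := by
  have h1 : a⁻¹ * b * a⁻¹⁻¹ = b * z := by rw [inv_inv, mul_assoc, h]; group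
  have h2 := conj_zpow (i := x) (a := a⁻¹) (b := b)
  have hc : Commute b z := Subgroup.mem_center_iff.1 hz b
  rw [h1, hc.mul_zpow, inv_inv] at h2
  rw [mul_assoc, h2]; group

theorem commutator_le_zpowers {a b z : G} (hab : Subgroup.closure {a, b} = ⊤)
    (hz : z ∈ Subgroup.center G) (h : b * a = a * b * z) :
    commutator G ≤ Subgroup.zpowers z := by
  have hzc : Subgroup.zpowers z ≤ Subgroup.center G := Subgroup.zpowers_le.2 hz
  have : (Subgroup.zpowers z).Normal :=
    ⟨fun n hn g ↦ by
      rwa [Subgroup.mem_center_iff.1 (hzc hn) g, mul_inv_cancel_right]⟩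
  let f := QuotientGroup.mk' (Subgroup.zpowers z)
  have hfz : f z = 1 := (QuotientGroup.eq_one_iff z).2 (Subgroup.mem_zpowers z)
  have hcomm : f b * f a = f a * f b := by
    rw [← map_mul, h, map_mul, hfz, mul_one, map_mul]
  have hgen : ∀ y, f a * y = y * f a → f b * y = y * f b → ∀ x, f x * y = y * f x := by
    intro y h1 h2 x
    have hx : x ∈ Subgroup.closure {a, b} := hab ▸ Subgroup.mem_top x
    have hle : Subgroup.closure {a, b} ≤ (Subgroup.centralizer {y}).comap f := by
      rw [Subgroup.closure_le]
      rintro x (rfl | rfl)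
      · exact Subgroup.mem_centralizer_singleton_iff.2 h1
      · exact Subgroup.mem_centralizer_singleton_iff.2 h2
    exact Subgroup.mem_centralizer_singleton_iff.1 (hle hx)
  have ha := hgen (f a) rfl hcomm
  have hb := hgen (f b) hcomm.symm rfl
  refine Subgroup.commutator_le.2 fun x _ y _ ↦ ?_
  have hxy := hgen (f y) (ha y).symm (hb y).symm x
  rw [← QuotientGroup.eq_one_iff, commutatorElement_def]
  change f (x * y * x⁻¹ * y⁻¹) = 1
  simp only [map_mul, map_inv, hxy, mul_inv_cancel_right, mul_inv_cancel]

theorem closure_pair_mul_zpow {a b : G} (hab : Subgroup.closure {a, b} = ⊤) (x : ℤ) :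
    Subgroup.closure {a * b ^ x, b} = ⊤ := by
  rw [eq_top_iff, ← hab, Subgroup.closure_le]
  have hb : b ∈ Subgroup.closure {a * b ^ x, b} := Subgroup.subset_closure (by simp)
  rintro y (rfl | rfl)
  · have h : y * b ^ x ∈ Subgroup.closure {y * b ^ x, b} := Subgroup.subset_closure (by simp)
    simpa using Subgroup.mul_mem _ h (Subgroup.inv_mem _ (Subgroup.zpow_mem _ hb x))
  · exact hb

/-- The subgroup generated by `b` and the commutator subgroup. -/
def commutatorHull (b : G) : Subgroup G := Subgroup.zpowers b ⊔ commutator G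

instance (b : G) : (commutatorHull b).Normal :=
  Subgroup.Normal.of_commutator_le G le_sup_right

theorem self_mem_commutatorHull (b : G) : b ∈ commutatorHull b :=
  Subgroup.mem_sup_left (Subgroup.mem_zpowers b)

theorem commutator_le_commutatorHull (b : G) : commutator G ≤ commutatorHull b := le_sup_right

theorem exists_of_mem_commutatorHull {b x : G} (h : x ∈ commutatorHull b) :
    ∃ l : ℤ, ∃ d ∈ commutator G, x = b ^ l * d := by
  obtain ⟨_, ⟨l, rfl⟩, d, hd, rfl⟩ := Subgroup.mem_sup_of_normal_right.1 h
  exact ⟨l, d, hd, rfl⟩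

theorem commutatorHull_le_centralizer (hcl : commutator G ≤ Subgroup.center G) (b : G) :
    commutatorHull b ≤ Subgroup.centralizer {b} :=
  sup_le (Subgroup.zpowers_le.2 (Subgroup.mem_centralizer_singleton_iff.2 rfl))
    (hcl.trans (Subgroup.center_le_centralizer _))

/-- The order of `a` modulo the subgroup generated by `b` and the commutator subgroup. -/
noncomputable def relOrder (a b : G) : ℕ := orderOf (a : G ⧸ commutatorHull b)

theorem zpow_mem_commutatorHull_iff {a b : G} {t : ℤ} :
    a ^ t ∈ commutatorHull b ↔ (relOrder a b : ℤ) ∣ t := by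
  rw [relOrder, orderOf_dvd_iff_zpow_eq_one, ← QuotientGroup.mk_zpow, QuotientGroup.eq_one_iff]

theorem pow_mem_commutatorHull_iff {a b : G} {t : ℕ} :
    a ^ t ∈ commutatorHull b ↔ relOrder a b ∣ t := by
  rw [← zpow_natCast, zpow_mem_commutatorHull_iff, Int.natCast_dvd_natCast]

theorem exists_mul_zpow_neg_mem_commutatorHull {a b : G} (hab : Subgroup.closure {a, b} = ⊤)
    (x : G) : ∃ t : ℤ, x * a ^ (-t) ∈ commutatorHull b := by
  have hle : Subgroup.closure {a, b} ≤ (Subgroup.zpowers (a : G ⧸ commutatorHull b)).comap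
      (QuotientGroup.mk' _) := by
    rw [Subgroup.closure_le]
    rintro y (rfl | rfl)
    · exact Subgroup.mem_zpowers _
    · change (y : G ⧸ commutatorHull y) ∈ Subgroup.zpowers (a : G ⧸ commutatorHull y)
      rw [(QuotientGroup.eq_one_iff y).2 (self_mem_commutatorHull y)]
      exact Subgroup.one_mem _
  obtain ⟨t, ht⟩ := hle (hab ▸ Subgroup.mem_top x)
  refine ⟨t, ?_⟩
  rw [← QuotientGroup.eq_one_iff, QuotientGroup.mk_mul, QuotientGroup.mk_zpow, zpow_neg,
    mul_inv_eq_one]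
  exact ht.symm

theorem IsMiller.inv_mul_apply_mem_center (hG : IsMiller G) (φ : MulAut G) (g : G) :
    g⁻¹ * φ g ∈ Subgroup.center G := by
  rw [Subgroup.mem_center_iff]
  intro y
  obtain ⟨x, rfl⟩ := φ.surjective y
  have h := DFunLike.congr_fun (hG.2.2 φ (MulAut.conj g)) x
  simp only [MulAut.mul_apply, MulAut.conj_apply, map_mul, map_inv] at h
  calc φ x * (g⁻¹ * φ g) = g⁻¹ * (g * φ x * g⁻¹) * φ g := by group
    _ = _ := by rw [← h]; group

theorem IsMiller.commutator_le_center (hG : IsMiller G) :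
    commutator G ≤ Subgroup.center G := by
  refine Subgroup.commutator_le.2 fun g _ h _ ↦ ?_
  have := hG.inv_mul_apply_mem_center (MulAut.conj h) g⁻¹
  simpa [commutatorElement_def, mul_assoc] using this

theorem IsMiller.pow_mem_center (hG : IsMiller G) {a b : G}
    (hab : Subgroup.closure {a, b} = ⊤) {k : ℕ}
    (h : (a * b ^ k) ^ relOrder a b = a ^ relOrder a b) : b ^ k ∈ Subgroup.center G := by
  have := hG.1
  obtain ⟨φ, hφ⟩ := exists_mulAut_mul_right (commutatorHull b) (a := a) (u := b ^ k)
    (exists_mul_zpow_neg_mem_commutatorHull hab)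
    (Subgroup.pow_mem _ (self_mem_commutatorHull b) k)
    (Subgroup.pow_mem _ (Subgroup.mem_centralizer_iff.2 fun x hx ↦
      Subgroup.mem_centralizer_singleton_iff.1
        (commutatorHull_le_centralizer hG.commutator_le_center b hx)) k)
    (fun t ht ↦ by
      obtain ⟨s, rfl⟩ := zpow_mem_commutatorHull_iff.1 ht
      rw [zpow_mul, zpow_mul, zpow_natCast, zpow_natCast, h])
  simpa [hφ] using hG.inv_mul_apply_mem_center φ a

theorem relOrder_ne_one (hcl : commutator G ≤ Subgroup.center G) {a b : G} (h : b * a ≠ a * b) :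
    relOrder a b ≠ 1 := by
  intro h1
  have : a ∈ commutatorHull b := by
    rw [← pow_one a, pow_mem_commutatorHull_iff, h1]
  exact h (Subgroup.mem_centralizer_singleton_iff.1 (commutatorHull_le_centralizer hcl b this)).symm

theorem relOrder_eq_prime_pow {p : ℕ} [Fact p.Prime] (hpG : IsPGroup p G) (a b : G) :
    ∃ m : ℕ, relOrder a b = p ^ m :=
  IsPGroup.iff_orderOf.1 (hpG.to_quotient _) _

theorem Nat.Prime.dvd_choose_two {p r : ℕ} (hp : p.Prime) (h : p ^ 2 ∣ r) : p ∣ r.choose 2 := by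
  have h2 : r.choose 2 * 2 = r * (r - 1) := by
    rw [Nat.choose_two_right, Nat.div_mul_cancel (Nat.even_mul_pred_self r).two_dvd]
  have h3 : p ^ 2 ∣ r.choose 2 * 2 := h2 ▸ h.mul_right _
  rcases eq_or_ne p 2 with rfl | hne
  · exact Nat.dvd_of_mul_dvd_mul_right two_pos (by simpa [sq] using h3)
  · exact ((Nat.coprime_primes hp Nat.prime_two).2 hne).dvd_of_dvd_mul_right
      ((dvd_pow_self p two_ne_zero).trans h3)

theorem exists_mem_commutator_mul_eq (a b : G) :
    ∃ z ∈ commutator G, b * a = a * b * z := by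
  refine ⟨_, Subgroup.commutator_mem_commutator (Subgroup.mem_top b⁻¹) (Subgroup.mem_top a⁻¹), ?_⟩
  rw [commutatorElement_def]; group

theorem IsMiller.pow_mul_pow_ne_one (hG : IsMiller G) {a b z : G}
    (hab : Subgroup.closure {a, b} = ⊤) (hz : z ∈ Subgroup.center G) (h : b * a = a * b * z)
    {k : ℕ} (hk : z ^ k ≠ 1) :
    (b ^ k) ^ relOrder a b * (z ^ k) ^ (relOrder a b).choose 2 ≠ 1 := by
  intro h1
  have h2 : b ^ k * a = a * b ^ k * z ^ k := by simpa using zpow_mul_eq hz h k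
  have h3 : b ^ k ∈ Subgroup.center G := hG.pow_mem_center hab <| by
    rw [mul_pow_of_mul_eq (Subgroup.pow_mem _ hz k) h2, mul_assoc, h1, mul_one]
  rw [← Subgroup.mem_center_iff.1 h3 a] at h2
  exact hk (left_eq_mul.1 h2)

theorem exists_pair_relOrder_minimal {p : ℕ} [Fact p.Prime] (hpG : IsPGroup p G)
    (hcl : commutator G ≤ Subgroup.center G) (h : ∃ a b : G, Subgroup.closure {a, b} = ⊤) :
    ∃ a b : G, Subgroup.closure {a, b} = ⊤ ∧ a ^ relOrder a b ∈ commutator G ∧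
      ∀ a' b' : G, Subgroup.closure {a', b'} = ⊤ → relOrder a b ∣ relOrder a' b' := by
  classical
  have hex : ∃ r, ∃ a b : G, Subgroup.closure {a, b} = ⊤ ∧ relOrder a b = r :=
    let ⟨a, b, hab⟩ := h
    ⟨_, a, b, hab, rfl⟩
  obtain ⟨a, b, hab, hr⟩ := Nat.find_spec hex
  have hdvd : ∀ a' b' : G, Subgroup.closure {a', b'} = ⊤ → relOrder a b ∣ relOrder a' b' := by
    intro a' b' h'
    have hle : relOrder a b ≤ relOrder a' b' := hr ▸ Nat.find_min' hex ⟨a', b', h', rfl⟩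
    obtain ⟨m, hm⟩ := relOrder_eq_prime_pow hpG a b
    obtain ⟨m', hm'⟩ := relOrder_eq_prime_pow hpG a' b'
    rw [hm, hm'] at hle ⊢
    exact pow_dvd_pow p ((Nat.pow_le_pow_iff_right (Fact.out : p.Prime).one_lt).1 hle)
  obtain ⟨l, d, hd, hl⟩ :=
    exists_of_mem_commutatorHull (pow_mem_commutatorHull_iff.2 (dvd_refl (relOrder a b)))
  have hbl : b ^ l ∈ commutatorHull a := by
    rw [eq_mul_inv_of_mul_eq hl.symm]
    exact Subgroup.mul_mem _ (Subgroup.pow_mem _ (self_mem_commutatorHull a) _)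
      (Subgroup.inv_mem _ (commutator_le_commutatorHull a hd))
  obtain ⟨x, hx⟩ : (relOrder a b : ℤ) ∣ l :=
    (Int.natCast_dvd_natCast.2 (hdvd b a (by rwa [Set.pair_comm]))).trans
      (zpow_mem_commutatorHull_iff.1 hbl)
  obtain ⟨z, hz, hza⟩ := exists_mem_commutator_mul_eq a b
  have hpow : (a * b ^ (-x)) ^ relOrder a b ∈ commutator G := by
    rw [mul_pow_of_mul_eq (Subgroup.zpow_mem _ (hcl hz) _) (zpow_mul_eq (hcl hz) hza (-x)), hl,
      ← zpow_natCast (b ^ (-x)), ← zpow_mul, hx]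
    refine Subgroup.mul_mem _ ?_ (Subgroup.pow_mem _ (Subgroup.zpow_mem _ hz _) _)
    rw [mul_assoc, ← Subgroup.mem_center_iff.1 (hcl hd), ← mul_assoc, ← zpow_add]
    convert hd
    rw [mul_eq_right, ← zpow_zero b]
    congr 1
    ring
  have hgen := closure_pair_mul_zpow hab (-x)
  have heq : relOrder (a * b ^ (-x)) b = relOrder a b :=
    Nat.dvd_antisymm (pow_mem_commutatorHull_iff.1 (commutator_le_commutatorHull b hpow))
      (hdvd _ _ hgen)
  exact ⟨_, b, hgen, by rwa [heq], by rwa [heq]⟩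

theorem IsMiller.closure_pair_ne_top {p : ℕ} [Fact p.Prime] (hG : IsMiller G)
    (hpG : IsPGroup p G) (a₀ b₀ : G) : Subgroup.closure {a₀, b₀} ≠ ⊤ := by
  intro h₀
  have hp : p.Prime := Fact.out
  have hcl := hG.commutator_le_center
  obtain ⟨a, b, hab, haq, hmin⟩ := exists_pair_relOrder_minimal hpG hcl ⟨a₀, b₀, h₀⟩
  have hba : Subgroup.closure {b, a} = ⊤ := by rwa [Set.pair_comm]
  obtain ⟨z, hzD, hz⟩ := exists_mem_commutator_mul_eq a b
  have hzc := hcl hzD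
  have hzi : a * b = b * a * z⁻¹ := by rw [hz, mul_inv_cancel_right]
  have hD := commutator_le_zpowers hab hzc hz
  have hz1 : z ≠ 1 := by
    rintro rfl
    obtain ⟨x, y, hxy⟩ := hG.2.1
    have h1 := hD
      (Subgroup.commutator_mem_commutator (Subgroup.mem_top x) (Subgroup.mem_top y))
    rw [Subgroup.zpowers_one_eq_bot, Subgroup.mem_bot,
      commutatorElement_eq_one_iff_mul_comm] at h1
    exact hxy h1
  obtain ⟨k, hwk, hk⟩ : ∃ k : ℕ, (z ^ k) ^ p = 1 ∧ z ^ k ≠ 1 := by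
    obtain ⟨n, hn⟩ := IsPGroup.iff_orderOf.1 hpG z
    obtain _ | n := n
    · exact absurd (orderOf_eq_one_iff.1 (by simpa using hn)) hz1
    · refine ⟨p ^ n, ?_, ?_⟩
      · rw [← pow_mul, ← pow_succ, ← hn, pow_orderOf_eq_one]
      · rw [Ne, ← orderOf_dvd_iff_pow_eq_one, hn, Nat.pow_dvd_pow_iff_le_right hp.one_lt]
        exact Nat.not_succ_le_self n
  have hki : z⁻¹ ^ k ≠ 1 := by rwa [inv_pow, Ne, inv_eq_one]
  have hw : ∀ t : ℤ, (z ^ k) ^ t = 1 ↔ (p : ℤ) ∣ t := fun t ↦ by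
    rw [← orderOf_dvd_iff_zpow_eq_one, orderOf_eq_prime hwk hk]
  have hq1 : relOrder a b ≠ 1 := relOrder_ne_one hcl fun h ↦ hz1 (left_eq_mul.1 (h ▸ hz))
  have hC := hG.pow_mul_pow_ne_one hab hzc hz hk
  have hC' := hG.pow_mul_pow_ne_one hba (Subgroup.inv_mem _ hzc) hzi hki
  obtain ⟨i, hi⟩ := hD haq
  have hzk : ∀ t : ℤ, (z ^ t) ^ k = (z ^ k) ^ t := fun t ↦ by
    rw [← zpow_natCast, ← zpow_natCast z, ← zpow_mul, ← zpow_mul, mul_comm]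
  have hak : (a ^ k) ^ relOrder a b = (z ^ k) ^ i := by
    rw [← pow_mul, mul_comm, pow_mul, ← hi, hzk]
  have hr : relOrder b a = relOrder a b := by
    by_contra hne
    obtain ⟨t, ht⟩ := hmin b a hba
    have hpq : p ∣ relOrder a b := by
      obtain ⟨m, hm⟩ := relOrder_eq_prime_pow hpG a b
      rw [hm] at hq1 ⊢
      exact dvd_pow_self p (by rintro rfl; exact hq1 (pow_zero p))
    have hpt : p ∣ t := by
      obtain ⟨m, hm⟩ := relOrder_eq_prime_pow hpG b a
      obtain ⟨s, -, hs⟩ := (Nat.dvd_prime_pow hp).1 (hm ▸ Dvd.intro_left _ ht.symm)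
      rw [hs]
      refine dvd_pow_self p ?_
      rintro rfl
      exact hne (by rw [ht, hs, pow_zero, mul_one])
    refine hC' ?_
    have hch : p ∣ (relOrder b a).choose 2 :=
      hp.dvd_choose_two (by rw [sq, ht]; exact mul_dvd_mul hpq hpt)
    rw [inv_pow, inv_pow, ← zpow_natCast (z ^ k), (hw _).2 (Int.natCast_dvd_natCast.2 hch), ht,
      pow_mul, hak, ← zpow_natCast, ← zpow_mul,
      (hw _).2 ((Int.natCast_dvd_natCast.2 hpt).mul_left i), inv_one, one_mul]
  have hbq : b ^ relOrder a b ∈ commutator G := by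
    obtain ⟨y, d, hd, hy⟩ :=
      exists_of_mem_commutatorHull (pow_mem_commutatorHull_iff.2 (dvd_refl (relOrder b a)))
    have hay : a ^ y ∈ commutatorHull b := by
      rw [eq_mul_inv_of_mul_eq hy.symm]
      exact Subgroup.mul_mem _ (Subgroup.pow_mem _ (self_mem_commutatorHull b) _)
        (Subgroup.inv_mem _ (commutator_le_commutatorHull b hd))
    obtain ⟨x, rfl⟩ := zpow_mem_commutatorHull_iff.1 hay
    rw [← hr, hy, zpow_mul, zpow_natCast]
    exact Subgroup.mul_mem _ (Subgroup.zpow_mem _ haq x) hd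
  obtain ⟨j, hj⟩ := hD hbq
  simp only at hi hj
  generalize hc : (relOrder a b).choose 2 = c at hC
  have hjc : ¬ (p : ℤ) ∣ j + c := by
    rwa [← hw, zpow_add, zpow_natCast, ← hzk, hj, ← pow_mul, mul_comm, pow_mul]
  obtain ⟨u, v, huv⟩ := (Nat.prime_iff_prime_int.1 hp).coprime_iff_not_dvd.2 hjc
  obtain ⟨x, hx⟩ : ∃ x : ℤ, (p : ℤ) ∣ i + j * x + x * c - c :=
    ⟨-(i - c) * v, (i - c) * u, by linear_combination -(i - c) * huv⟩
  have hgen : Subgroup.closure {b, a * b ^ x} = ⊤ := by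
    rw [Set.pair_comm]; exact closure_pair_mul_zpow hab x
  have hz' : a * b ^ x * b = b * (a * b ^ x) * z⁻¹ := by
    rw [← mul_assoc b, hz, mul_assoc (a * b), ← Subgroup.mem_center_iff.1 hzc (b ^ x)]
    group
  have hr' : relOrder b (a * b ^ x) = relOrder a b :=
    Nat.dvd_antisymm (pow_mem_commutatorHull_iff.1 (commutator_le_commutatorHull _ hbq))
      (hmin _ _ hgen)
  refine hG.pow_mul_pow_ne_one hgen (Subgroup.inv_mem _ hzc) hz' hki ?_
  rw [hr', hc, ← pow_mul, mul_comm k, pow_mul,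
    mul_pow_of_mul_eq (Subgroup.zpow_mem _ hzc x) (zpow_mul_eq hzc hz x), hc, ← hi,
    ← zpow_natCast (b ^ x), ← zpow_mul, mul_comm x, zpow_mul, zpow_natCast, ← hj, ← zpow_natCast
    (z ^ x), ← zpow_mul, ← zpow_mul, ← zpow_add, ← zpow_add, hzk, inv_pow, inv_pow,
    ← zpow_natCast (z ^ k) c, ← zpow_neg, ← zpow_add, hw]
  exact hx

end

/-- Every generating set of a Miller `p`-group has at least `3` elements. -/
theorem miller_pGroup_generators_ge_three
    (p : ℕ) (hp : p.Prime)
    (G : Type*) [Group G] (hG : IsMiller G) (hpG : IsPGroup p G) :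
    ∀ s : Set G, Subgroup.closure s = ⊤ → 3 ≤ s.ncard := by
  intro s hs
  have := Fact.mk hp
  have := hG.1
  by_contra! hlt
  obtain ⟨a, b, hsub⟩ : ∃ a b : G, s ⊆ {a, b} := by
    have h : s.ncard = 0 ∨ s.ncard = 1 ∨ s.ncard = 2 := by omega
    rcases h with h | h | h
    · exact ⟨1, 1, by simp [(Set.ncard_eq_zero s.toFinite).1 h]⟩
    · obtain ⟨a, rfl⟩ := Set.ncard_eq_one.1 h
      exact ⟨a, a, by simp⟩
    · obtain ⟨a, b, -, rfl⟩ := Set.ncard_eq_two.1 h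
      exact ⟨a, b, subset_rfl⟩
  exact hG.closure_pair_ne_top hpG a b (top_le_iff.1 (hs ▸ Subgroup.closure_mono hsub))
end
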